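/- Let S(n) := Σ_{j=1}^{n-1} (-1)^{j-1} C(n-1, j) / h_j, where h_j = Σ_{i=1}^j 1/i, and let s₁ ∈ (-1,0) be the unique root of ψ(s) = ψ(1) in (-1,0). Then there is a constant C such that for all n ≥ 2, |S(n) - (6/π²)·log n - (ζ(3)/ζ(2)² + γ/ζ(2)) + 3/(π²·n)| ≤ C · n^{-1-|s₁|}, where γ is the Euler–Mascheroni constant, ζ(2) = π²/6 and ζ(3) = Σ_{k≥1} k^{-3}. -/

import Mathlib

/-- The digamma function on the reals: `ψ(x) = Γ'(x)/Γ(x)`. -/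
noncomputable def digamma (x : ℝ) : ℝ := deriv Real.Gamma x / Real.Gamma x

/-- The `m`-th harmonic number `h_m = ∑_{i=1}^m 1/i`, with `h_0 = 0`. -/
noncomputable def harm (m : ℕ) : ℝ := ∑ i ∈ Finset.range m, (1 : ℝ) / (i + 1)

/-- `S(n) = Σ_{j=1}^{n-1} (-1)^{j-1} C(n-1, j) / h_j` (equal to `E[D_n]` in the paper). -/
noncomputable def S (n : ℕ) : ℝ :=
  ∑ j ∈ Finset.Icc 1 (n - 1), (-1 : ℝ) ^ (j - 1) * ((n - 1).choose j) / harm j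

/-- `ζ(3) = Σ_{k≥1} k⁻³`. -/
noncomputable def zeta3 : ℝ := ∑' k : ℕ, (1 : ℝ) / ((k : ℝ) + 1) ^ 3


/-- Truncation of `ψ(s+1) - ψ(1)`. -/
noncomputable def HM (M : ℕ) (s : ℝ) : ℝ :=
  ∑ k ∈ Finset.range M, (1 / ((k : ℝ) + 1) - 1 / ((k : ℝ) + 1 + s))

lemma HM_deriv (M : ℕ) (x : ℝ) (hx : ∀ k ∈ Finset.range M, (k : ℝ) + 1 + x ≠ 0) :
    HasDerivAt (HM M) (∑ k ∈ Finset.range M, 1 / ((k : ℝ) + 1 + x) ^ 2) x := by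
  unfold HM
  apply HasDerivAt.fun_sum
  intro k hk
  have h1 : HasDerivAt (fun s : ℝ => (k : ℝ) + 1 + s) 1 x := by
    simpa using (hasDerivAt_id x).const_add ((k : ℝ) + 1)
  have h2 := (h1.inv (hx k hk)).const_sub (1 / ((k : ℝ) + 1))
  convert h2 using 1
  · funext s; simp
  · ring

lemma HM_root (M i : ℕ) (h1 : 1 ≤ i) (h2 : i < M) :
    ∃ x : ℝ, HM M x = 0 ∧ -((i : ℝ) + 1) < x ∧ x < -(i : ℝ) := by
  obtain ⟨i, rfl⟩ : ∃ j, i = j + 1 := ⟨i - 1, by omega⟩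
  set T := ((Finset.range M).erase (i + 1)).erase i with hT
  set A : ℝ → ℝ := fun s => ∑ k ∈ Finset.range M, 1 / ((k : ℝ) + 1)
    - ∑ k ∈ T, 1 / ((k : ℝ) + 1 + s) with hA
  have hsplit : ∀ s : ℝ, HM M s = A s - 1 / ((i : ℝ) + 1 + s) - 1 / ((i : ℝ) + 2 + s) := by
    intro s
    unfold HM
    rw [Finset.sum_sub_distrib, ← Finset.add_sum_erase (Finset.range M) _ (Finset.mem_range.2 h2),
      ← Finset.add_sum_erase (Finset.range M) (fun k : ℕ => 1 / ((k : ℝ) + 1 + s))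
        (Finset.mem_range.2 h2),
      ← Finset.add_sum_erase ((Finset.range M).erase (i + 1))
        (fun k : ℕ => 1 / ((k : ℝ) + 1 + s)) (a := i) (by simp; omega), hA]
    simp only
    rw [← Finset.add_sum_erase (Finset.range M) (fun k : ℕ => 1 / ((k : ℝ) + 1))
      (Finset.mem_range.2 h2)]
    have e : ((i + 1 : ℕ) : ℝ) + 1 + s = (i : ℝ) + 2 + s := by push_cast; ring
    rw [e]
    ring
  have hcont : ContinuousOn A (Set.Icc (-((i : ℝ) + 2)) (-((i : ℝ) + 1))) := by
    rw [hA]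
    apply ContinuousOn.sub continuousOn_const
    apply continuousOn_finsetSum
    intro k hk
    apply ContinuousOn.div continuousOn_const (by fun_prop)
    intro s hs
    simp only [hT, Finset.mem_erase, Finset.mem_range] at hk
    rcases lt_or_gt_of_ne hk.1 with h | h
    · have : (k : ℝ) + 1 ≤ i := by exact_mod_cast h
      have := hs.2
      intro h0; linarith
    · have : (i : ℝ) + 2 ≤ k := by
        have : i + 2 ≤ k := by omega
        exact_mod_cast this
      have := hs.1
      intro h0; linarith
  have hcont2 : ContinuousOn (fun s => A s * (((i : ℝ) + 1 + s) * ((i : ℝ) + 2 + s))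
      - ((i : ℝ) + 2 + s) - ((i : ℝ) + 1 + s)) (Set.Icc (-((i : ℝ) + 2)) (-((i : ℝ) + 1))) := by
    fun_prop
  have := intermediate_value_Ioo' (by linarith) hcont2
  have h0 : (0 : ℝ) ∈ (fun s => A s * (((i : ℝ) + 1 + s) * ((i : ℝ) + 2 + s))
      - ((i : ℝ) + 2 + s) - ((i : ℝ) + 1 + s)) '' (Set.Ioo (-((i : ℝ) + 2)) (-((i : ℝ) + 1))) := by
    apply this
    constructor
    · ring_nf; norm_num
    · ring_nf; norm_num
  obtain ⟨x, hx, hx0⟩ := h0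
  refine ⟨x, ?_, ?_, ?_⟩
  · rw [hsplit]
    have a1 : (i : ℝ) + 1 + x ≠ 0 := by have := hx.2; intro h; linarith
    have a2 : (i : ℝ) + 2 + x ≠ 0 := by have := hx.1; intro h; linarith
    simp only at hx0
    field_simp
    linarith
  · have := hx.1; push_cast; linarith
  · have := hx.2; push_cast; linarith

open Polynomial in
lemma HM_pf (M : ℕ) (hM : 1 ≤ M) (v : ℕ → ℝ)
    (hroot : ∀ i ∈ Finset.range M, HM M (v i) = 0)
    (hinj : Set.InjOn v (Finset.range M))
    (hpole : ∀ i ∈ Finset.range M, ∀ k ∈ Finset.range M, (k : ℝ) + 1 + v i ≠ 0)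
    (s : ℝ) (hs : 0 < s) (hsv : ∀ i ∈ Finset.range M, s ≠ v i) :
    1 / HM M s = 1 / harm M + ∑ i ∈ Finset.range M,
      (1 / ∑ k ∈ Finset.range M, 1 / ((k : ℝ) + 1 + v i) ^ 2) / (s - v i) := by
  set R := Finset.range M with hR
  set Q : ℝ[X] := ∏ k ∈ R, (X + C ((k : ℝ) + 1)) with hQ
  set E : ℝ[X] := ∑ k ∈ R, ∏ j ∈ R.erase k, (X + C ((j : ℝ) + 1)) with hE
  set P : ℝ[X] := C (harm M) * Q - E with hP
  have hh : 0 < harm M := by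
    unfold harm
    apply Finset.sum_pos
    · intro i _; positivity
    · simp; omega
  have hQe : ∀ x : ℝ, Q.eval x = ∏ k ∈ R, ((k : ℝ) + 1 + x) := by
    intro x
    rw [hQ, eval_prod]
    apply Finset.prod_congr rfl
    intro k _
    simp; ring
  have hQne : ∀ x : ℝ, (∀ k ∈ R, (k : ℝ) + 1 + x ≠ 0) → Q.eval x ≠ 0 := by
    intro x hx
    rw [hQe, Finset.prod_ne_zero_iff]
    exact hx
  have hPe : ∀ x : ℝ, (∀ k ∈ R, (k : ℝ) + 1 + x ≠ 0) → P.eval x = HM M x * Q.eval x := by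
    intro x hx
    have h1 : HM M x = harm M - ∑ k ∈ R, 1 / ((k : ℝ) + 1 + x) := by
      unfold HM harm; rw [Finset.sum_sub_distrib]
    have h2 : E.eval x = (∑ k ∈ R, 1 / ((k : ℝ) + 1 + x)) * Q.eval x := by
      rw [hE, eval_finsetSum, Finset.sum_mul]
      apply Finset.sum_congr rfl
      intro k hk
      rw [hQe, ← Finset.mul_prod_erase R _ hk, eval_prod]
      have : ∏ j ∈ R.erase k, eval x (X + C ((j : ℝ) + 1)) = ∏ j ∈ R.erase k, ((j : ℝ) + 1 + x) := by
        apply Finset.prod_congr rfl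
        intro k _
        simp; ring
      rw [this]
      have := hx k hk
      field_simp
    rw [hP, eval_sub, eval_mul, eval_C, h2, h1]; ring
  have hEdeg : E.degree < (R.card : WithBot ℕ) := by
    rw [hE]
    apply lt_of_le_of_lt (degree_sum_le _ _)
    rw [Finset.sup_lt_iff (by exact WithBot.bot_lt_coe _)]
    intro k hk
    rw [degree_prod]
    simp only [degree_X_add_C, Finset.sum_const, nsmul_eq_mul, mul_one, Finset.card_erase_of_mem hk]
    have : 0 < R.card := Finset.card_pos.2 ⟨k, hk⟩
    exact_mod_cast Nat.sub_lt this one_pos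
  have hQm : Q.Monic := monic_prod_of_monic _ _ (fun k _ => monic_X_add_C _)
  have hQdeg : Q.degree = (R.card : WithBot ℕ) := by
    rw [hQ, degree_prod]; simp only [degree_X_add_C]; simp
  have hPn : P = C (harm M) * Lagrange.nodal R v := by
    apply eq_of_degree_sub_lt_of_eval_index_eq R hinj
    · have : P - C (harm M) * Lagrange.nodal R v
          = C (harm M) * (Q - Lagrange.nodal R v) - E := by rw [hP]; ring
      rw [this]
      apply lt_of_le_of_lt (degree_sub_le _ _)
      apply max_lt _ hEdeg
      rw [degree_C_mul hh.ne']
      rw [← hQdeg]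
      apply degree_sub_lt_left
      · rw [hQdeg, Lagrange.degree_nodal]
      · exact hQm.ne_zero
      · rw [hQm.leadingCoeff, (Lagrange.nodal_monic).leadingCoeff]
    · intro i hi
      rw [hPe _ (hpole i hi), hroot i hi]
      simp [Lagrange.eval_nodal_at_node hi]
  have hEi : E = Lagrange.interpolate R v (fun i => harm M * Q.eval (v i)) := by
    apply Lagrange.eq_interpolate_of_eval_eq _ hinj hEdeg
    intro i hi
    have h1 := hPe _ (hpole i hi)
    rw [hroot i hi, hP] at h1
    simp at h1
    linarith
  have hEs := Lagrange.eval_interpolate_not_at_node (fun i => harm M * Q.eval (v i)) hsv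
  rw [← hEi] at hEs
  have hspole : ∀ k ∈ R, (k : ℝ) + 1 + s ≠ 0 := fun k _ => by positivity
  have hn := Lagrange.eval_nodal_not_at_node hsv
  have hw : ∀ i ∈ R, Lagrange.nodalWeight R v i * (s - v i)⁻¹ * (harm M * Q.eval (v i))
      = harm M ^ 2 * ((1 / ∑ k ∈ R, 1 / ((k : ℝ) + 1 + v i) ^ 2) / (s - v i)) := by
    intro i hi
    have hd1 := (HM_deriv M (v i) (hpole i hi)).mul (Q.hasDerivAt (v i))
    have hd2 : HasDerivAt (fun x => P.eval x)
        ((∑ k ∈ R, 1 / ((k : ℝ) + 1 + v i) ^ 2) * Q.eval (v i)) (v i) := by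
      rw [hroot i hi, zero_mul, add_zero] at hd1
      apply hd1.congr_of_eventuallyEq
      have : ∀ᶠ x in nhds (v i), ∀ k ∈ R, (k : ℝ) + 1 + x ≠ 0 := by
        rw [Filter.eventually_all_finset]
        intro k hk
        have hc : ContinuousAt (fun x : ℝ => (k : ℝ) + 1 + x) (v i) := by fun_prop
        exact hc.eventually_ne (hpole i hi k hk)
      filter_upwards [this] with x hx
      rw [hPe x hx]; rfl
    have hd3 := (P.hasDerivAt (v i)).unique hd2
    rw [hPn] at hd3
    simp only [derivative_C_mul, eval_mul, eval_C] at hd3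
    rw [Lagrange.nodalWeight_eq_eval_derivative_nodal hi]
    have hq := hQne _ (hpole i hi)
    have hS : (∑ k ∈ R, 1 / ((k : ℝ) + 1 + v i) ^ 2) ≠ 0 := by
      apply ne_of_gt
      apply Finset.sum_pos
      · intro k hk
        have := hpole i hi k hk
        positivity
      · exact ⟨i, hi⟩
    set W := eval (v i) (derivative (Lagrange.nodal R v))
    have hW : W ≠ 0 := by
      intro h; rw [h, mul_zero] at hd3
      exact (mul_ne_zero hS hq) hd3.symm
    have hsv' := sub_ne_zero.2 (hsv i hi)
    set Z := (∑ k ∈ R, 1 / ((k : ℝ) + 1 + v i) ^ 2)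
    field_simp
    linarith
  rw [Finset.sum_congr rfl hw, ← Finset.mul_sum] at hEs
  set Y := ∑ i ∈ R, (1 / ∑ k ∈ R, 1 / ((k : ℝ) + 1 + v i) ^ 2) / (s - v i)
  have h1 := hPe s hspole
  have h2 : P.eval s = harm M * (Lagrange.nodal R v).eval s := by rw [hPn]; simp
  have h3 : P.eval s = harm M * Q.eval s - E.eval s := by rw [hP]; simp
  have hPs : P.eval s ≠ 0 := by rw [h2]; exact mul_ne_zero hh.ne' hn
  have hH : HM M s ≠ 0 := by
    intro h; rw [h, zero_mul] at h1; exact hPs h1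
  have hq := hQne s hspole
  rw [hEs] at h3
  set n := (Lagrange.nodal R v).eval s
  set q := Q.eval s
  have h4 : HM M s * q = harm M * n := by rw [← h1, h2]
  have h5 : harm M * n = harm M * q - n * (harm M ^ 2 * Y) := by rw [← h2, h3]
  have h6 : n * (1 + harm M * Y) = q := by
    have : harm M * (n * (1 + harm M * Y) - q) = 0 := by linear_combination h5
    rcases mul_eq_zero.1 this with h | h
    · exact absurd h hh.ne'
    · linarith
  have h7 : HM M s * (1 + harm M * Y) = harm M := by
    have : n * (HM M s * (1 + harm M * Y) - harm M) = 0 := by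
      linear_combination h4 + HM M s * h6
    rcases mul_eq_zero.1 this with h | h
    · exact absurd h hn
    · linarith
  field_simp
  linarith

lemma HM_structure (s₁ : ℝ) (hs₁ : s₁ ∈ Set.Ioo (-1:ℝ) 0) (M : ℕ) (hM : 1 ≤ M)
    (hpos : 0 ≤ HM M (s₁ - 1)) :
    ∃ w ρ : ℕ → ℝ, (∀ i ∈ Finset.Ico 1 M, 0 ≤ w i ∧ 1 - s₁ ≤ ρ i) ∧
      ∀ s : ℝ, 0 < s → 1 / HM M s = 1 / harm M
        + (1 / ∑ k ∈ Finset.range M, 1 / ((k : ℝ) + 1) ^ 2) / s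
        + ∑ i ∈ Finset.Ico 1 M, w i / (s + ρ i) := by
  have hex : ∀ i : ℕ, ∃ x : ℝ, i < M → (HM M x = 0 ∧ -((i : ℝ) + 1) < x ∧ x ≤ -(i : ℝ) ∧
      (1 ≤ i → x < -(i : ℝ)) ∧ (i = 0 → x = 0)) := by
    intro i
    by_cases hi : i < M
    · rcases Nat.eq_zero_or_pos i with h | h
      · refine ⟨0, fun _ => ⟨?_, ?_, ?_, ?_, ?_⟩⟩
        · simp [HM]
        · simp [h]
        · simp [h]
        · omega
        · simp
      · obtain ⟨x, h1, h2, h3⟩ := HM_root M i h hi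
        exact ⟨x, fun _ => ⟨h1, h2, h3.le, fun _ => h3, by omega⟩⟩
    · exact ⟨0, fun h => absurd h hi⟩
  choose v hv using hex
  have hinj : Set.InjOn v (Finset.range M) := by
    intro i hi j hj hij
    simp only [Finset.coe_range, Set.mem_Iio] at hi hj
    obtain ⟨_, a1, a2, _⟩ := hv i hi
    obtain ⟨_, b1, b2, _⟩ := hv j hj
    rw [hij] at a1 a2
    have c1 : (i : ℝ) < j + 1 := by linarith
    have c2 : (j : ℝ) < i + 1 := by linarith
    have c1' : i < j + 1 := by exact_mod_cast c1
    have c2' : j < i + 1 := by exact_mod_cast c2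
    omega
  have hpole : ∀ i ∈ Finset.range M, ∀ k ∈ Finset.range M, (k : ℝ) + 1 + v i ≠ 0 := by
    intro i hi k hk h
    obtain ⟨_, a1, a2, a3, a4⟩ := hv i (Finset.mem_range.1 hi)
    rcases Nat.eq_zero_or_pos i with h0 | h0
    · rw [a4 h0] at h
      have : (0:ℝ) ≤ k := by positivity
      linarith
    · have a5 := a3 h0
      have c1 : (i : ℝ) < k + 1 := by linarith
      have c2 : (k : ℝ) < i := by linarith
      have c1' : i < k + 1 := by exact_mod_cast c1
      have c2' : k < i := by exact_mod_cast c2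
      omega
  refine ⟨fun i => 1 / ∑ k ∈ Finset.range M, 1 / ((k : ℝ) + 1 + v i) ^ 2, fun i => - v i,
    ?_, ?_⟩
  · intro i hi
    rw [Finset.mem_Ico] at hi
    obtain ⟨a0, a1, a2, a3, a4⟩ := hv i hi.2
    constructor
    · positivity
    · rcases Nat.lt_or_ge i 2 with h | h
      · have hi1 : i = 1 := by omega
        subst hi1
        have a5 := a3 le_rfl
        norm_num at a1 a5
        by_contra hcon
        push Not at hcon
        have hlt : s₁ - 1 < v 1 := by linarith
        have : HM M (s₁ - 1) < HM M (v 1) := by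
          unfold HM
          apply Finset.sum_lt_sum_of_nonempty
          · simp; omega
          · intro k hk
            have hgoal : 1 / ((k : ℝ) + 1 + v 1) < 1 / ((k : ℝ) + 1 + (s₁ - 1)) := by
              rcases Nat.eq_zero_or_pos k with hk0 | hk0
              · subst hk0
                apply one_div_lt_one_div_of_neg_of_lt
                · simp; linarith
                · linarith
              · have : (1 : ℝ) ≤ k := by exact_mod_cast hk0
                apply one_div_lt_one_div_of_lt
                · have := hs₁.1; linarith
                · linarith
            linarith
        linarith
      · have : (2 : ℝ) ≤ i := by exact_mod_cast h
        have := hs₁.1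
        linarith
  · intro s hs
    rw [HM_pf M hM v (fun i hi => (hv i (Finset.mem_range.1 hi)).1) hinj hpole s hs]
    · rw [Finset.range_eq_Ico, Finset.sum_eq_sum_Ico_succ_bot (by omega : 0 < M)]
      have h0 : v 0 = 0 := (hv 0 (by omega)).2.2.2.2 rfl
      simp only [h0, add_zero, sub_zero, zero_add, ← sub_eq_add_neg]
      ring
    · intro i hi h
      obtain ⟨_, a1, a2, a3, a4⟩ := hv i (Finset.mem_range.1 hi)
      have : (0 : ℝ) ≤ i := by positivity
      linarith

/-- The constant term. -/
lemma HM_const (M : ℕ) (hM : 1 ≤ M) (w ρ : ℕ → ℝ) (hρ : ∀ i ∈ Finset.Ico 1 M, 0 < ρ i)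
    (h : ∀ s : ℝ, 0 < s → 1 / HM M s = 1 / harm M
        + (1 / ∑ k ∈ Finset.range M, 1 / ((k : ℝ) + 1) ^ 2) / s
        + ∑ i ∈ Finset.Ico 1 M, w i / (s + ρ i)) :
    1 / harm M + ∑ i ∈ Finset.Ico 1 M, w i / ρ i =
      (∑ k ∈ Finset.range M, 1 / ((k : ℝ) + 1) ^ 3)
        / (∑ k ∈ Finset.range M, 1 / ((k : ℝ) + 1) ^ 2) ^ 2 := by
  set z2 := ∑ k ∈ Finset.range M, 1 / ((k : ℝ) + 1) ^ 2 with hz2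
  set G : ℝ → ℝ := fun s => ∑ k ∈ Finset.range M, 1 / (((k : ℝ) + 1) * ((k : ℝ) + 1 + s)) with hG
  set K : ℝ → ℝ := fun s => ∑ k ∈ Finset.range M, 1 / (((k : ℝ) + 1) ^ 2 * ((k : ℝ) + 1 + s)) with hK
  have hne : (Finset.range M).Nonempty := by simp; omega
  have hGpos : ∀ s : ℝ, 0 ≤ s → 0 < G s := by
    intro s hs
    apply Finset.sum_pos _ hne
    intro k _; positivity
  have hz2pos : 0 < z2 := by
    apply Finset.sum_pos _ hne
    intro k _; positivity
  have hHG : ∀ s : ℝ, 0 < s → HM M s = s * G s := by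
    intro s hs
    rw [hG]; simp only
    rw [Finset.mul_sum]
    unfold HM
    apply Finset.sum_congr rfl
    intro k _
    field_simp
    ring
  have hGK : ∀ s : ℝ, 0 < s → z2 - G s = s * K s := by
    intro s hs
    rw [hG, hK, hz2]; simp only
    rw [Finset.mul_sum, ← Finset.sum_sub_distrib]
    apply Finset.sum_congr rfl
    intro k _
    field_simp
    ring
  have hcG : ContinuousWithinAt G (Set.Ioi 0) 0 := by
    apply ContinuousAt.continuousWithinAt
    rw [hG]
    apply tendsto_finsetSum
    intro k _
    apply ContinuousAt.div continuousAt_const (by fun_prop)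
    positivity
  have hcK : ContinuousWithinAt K (Set.Ioi 0) 0 := by
    apply ContinuousAt.continuousWithinAt
    rw [hK]
    apply tendsto_finsetSum
    intro k _
    apply ContinuousAt.div continuousAt_const (by fun_prop)
    positivity
  have hcL : ContinuousWithinAt (fun s => 1 / harm M + ∑ i ∈ Finset.Ico 1 M, w i / (s + ρ i))
      (Set.Ioi 0) 0 := by
    apply ContinuousAt.continuousWithinAt
    apply ContinuousAt.add continuousAt_const
    apply tendsto_finsetSum
    intro k hk
    apply ContinuousAt.div continuousAt_const (by fun_prop)
    have := hρ k hk
    rw [zero_add]; exact this.ne'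
  have hcR := (hcK.div (continuousWithinAt_const.mul hcG) (mul_ne_zero hz2pos.ne' (hGpos 0 le_rfl).ne'))
  have hev : (fun s => 1 / harm M + ∑ i ∈ Finset.Ico 1 M, w i / (s + ρ i))
      =ᶠ[nhdsWithin 0 (Set.Ioi 0)] (fun s => K s / (z2 * G s)) := by
    filter_upwards [self_mem_nhdsWithin] with s hs
    have hs : (0:ℝ) < s := hs
    have h1 := h s hs
    rw [hHG s hs] at h1
    have h2 := hGK s hs
    have h3 := hGpos s hs.le
    have h4 : 1 / harm M + ∑ i ∈ Finset.Ico 1 M, w i / (s + ρ i) = 1 / (s * G s) - 1 / z2 / s := by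
      linarith
    rw [h4]
    field_simp
    linarith
  have huniq := tendsto_nhds_unique (hcL.congr' hev) hcR
  have hG0 : G 0 = z2 := by
    rw [hG, hz2]; simp only [add_zero]
    apply Finset.sum_congr rfl; intro k _; ring
  have hK0 : K 0 = ∑ k ∈ Finset.range M, 1 / ((k : ℝ) + 1) ^ 3 := by
    rw [hK]; simp only [add_zero]
    apply Finset.sum_congr rfl; intro k _; ring
  simp only [zero_add] at huniq
  rw [huniq, sq]
  change K 0 / (z2 * G 0) = _
  rw [hG0, hK0]

/-- The alternating binomial sum. -/
noncomputable def Alt (N : ℕ) (f : ℕ → ℝ) : ℝ :=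
  ∑ j ∈ Finset.Icc 1 N, (-1 : ℝ) ^ (j - 1) * (N.choose j) * f j

/-- Full alternating binomial sum. -/
noncomputable def FAlt (N : ℕ) (f : ℕ → ℝ) : ℝ :=
  ∑ j ∈ Finset.range (N + 1), (-1 : ℝ) ^ j * (N.choose j) * f j

lemma Alt_eq (N : ℕ) (f : ℕ → ℝ) : Alt N f = f 0 - FAlt N f := by
  unfold Alt FAlt
  rw [Finset.sum_range_succ', Finset.range_eq_Ico,
    Finset.sum_Ico_add' (fun j => (-1 : ℝ) ^ j * (N.choose j) * f j) 0 N 1]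
  have : Finset.Icc 1 N = Finset.Ico (0 + 1) (N + 1) := by
    rfl
  rw [this]
  have h2 : ∑ j ∈ Finset.Ico (0 + 1) (N + 1), (-1 : ℝ) ^ (j - 1) * (N.choose j) * f j
      = - ∑ j ∈ Finset.Ico (0 + 1) (N + 1), (-1 : ℝ) ^ j * (N.choose j) * f j := by
    rw [← Finset.sum_neg_distrib]
    apply Finset.sum_congr rfl
    intro j hj
    rw [Finset.mem_Ico] at hj
    obtain ⟨i, rfl⟩ : ∃ i, j = i + 1 := ⟨j - 1, by omega⟩
    rw [Nat.add_sub_cancel, pow_succ]; ring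
  rw [h2]; simp

lemma FAlt_succ (N : ℕ) (f : ℕ → ℝ) :
    FAlt (N + 1) f = FAlt N f - FAlt N (fun j => f (j + 1)) := by
  have h0 : FAlt N f = ∑ j ∈ Finset.range (N + 1), (-1 : ℝ) ^ (j + 1) * (N.choose (j + 1)) * f (j + 1)
      + f 0 := by
    have : FAlt N f = ∑ j ∈ Finset.range (N + 1 + 1), (-1 : ℝ) ^ j * (N.choose j) * f j := by
      rw [Finset.sum_range_succ]; simp [FAlt]
    rw [this, Finset.sum_range_succ']; simp
  rw [h0]
  unfold FAlt
  rw [Finset.sum_range_succ']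
  simp only [Nat.choose_succ_succ]
  push_cast
  have : ∀ a b c : ℝ, a + b - c = (a - c) + b := by intros; ring
  rw [this, ← Finset.sum_sub_distrib]
  congr 1
  · apply Finset.sum_congr rfl
    intro j _
    simp only [Nat.succ_eq_add_one]
    ring
  · simp

lemma FAlt_inv (N : ℕ) : ∀ x : ℝ, 0 < x →
    FAlt N (fun j => 1 / ((j : ℝ) + x)) = N.factorial / ∏ i ∈ Finset.range (N + 1), (x + i) := by
  induction N with
  | zero => intro x hx; simp [FAlt]
  | succ N ih =>
    intro x hx
    rw [FAlt_succ, ih x hx]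
    have : (fun j : ℕ => 1 / (((j + 1 : ℕ) : ℝ) + x)) = fun j : ℕ => 1 / ((j : ℝ) + (x + 1)) := by
      funext j; push_cast; congr 1; ring
    rw [this, ih (x + 1) (by linarith)]
    have e1 : ∏ i ∈ Finset.range (N + 1 + 1), (x + (i : ℝ))
        = x * ∏ i ∈ Finset.range (N + 1), (x + 1 + (i : ℝ)) := by
      rw [Finset.prod_range_succ', mul_comm]
      congr 1
      · simp
      · apply Finset.prod_congr rfl; intro i _; push_cast; ring
    have e2 : ∏ i ∈ Finset.range (N + 1 + 1), (x + (i : ℝ))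
        = (∏ i ∈ Finset.range (N + 1), (x + (i : ℝ))) * (x + (N + 1)) := by
      rw [Finset.prod_range_succ]; push_cast; rfl
    have p1 : 0 < ∏ i ∈ Finset.range (N + 1), (x + (i : ℝ)) :=
      Finset.prod_pos (fun i _ => by positivity)
    have p2 : 0 < ∏ i ∈ Finset.range (N + 1), (x + 1 + (i : ℝ)) :=
      Finset.prod_pos (fun i _ => by positivity)
    rw [e1] at e2
    rw [e1]
    set A := ∏ i ∈ Finset.range (N + 1), (x + (i : ℝ))
    set B := ∏ i ∈ Finset.range (N + 1), (x + 1 + (i : ℝ))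
    rw [Nat.factorial_succ]
    push_cast
    field_simp
    linear_combination e2

lemma Alt_one (N : ℕ) (hN : 1 ≤ N) : Alt N (fun _ => 1) = 1 := by
  rw [Alt_eq]
  obtain ⟨n, rfl⟩ : ∃ n, N = n + 1 := ⟨N - 1, by omega⟩
  rw [FAlt_succ]; simp

lemma Alt_harm (N : ℕ) : Alt N (fun j => 1 / (j : ℝ)) = harm N := by
  induction N with
  | zero => simp [Alt, harm]
  | succ N ih =>
    rw [Alt_eq, FAlt_succ]
    have h1 := Alt_eq N (fun j => 1 / (j : ℝ))
    have h2 := FAlt_inv N 1 one_pos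
    have h3 : (fun j : ℕ => 1 / (((j + 1 : ℕ) : ℝ))) = fun j : ℕ => 1 / ((j : ℝ) + 1) := by
      funext j; push_cast; rfl
    rw [h3, h2]
    have h4 : ∏ i ∈ Finset.range (N + 1), (1 + (i : ℝ)) = (N + 1).factorial := by
      rw [← Finset.prod_range_add_one_eq_factorial]
      push_cast
      apply Finset.prod_congr rfl; intros; ring
    rw [h4]
    have h5 : harm (N + 1) = harm N + 1 / ((N : ℝ) + 1) := by
      unfold harm; rw [Finset.sum_range_succ]
    rw [h5, ← ih, h1, Nat.factorial_succ]
    push_cast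
    have : (N.factorial : ℝ) ≠ 0 := by positivity
    field_simp
    ring

lemma Alt_add (N : ℕ) (f g : ℕ → ℝ) : Alt N (fun j => f j + g j) = Alt N f + Alt N g := by
  unfold Alt
  rw [← Finset.sum_add_distrib]
  apply Finset.sum_congr rfl; intros; ring

lemma Alt_smul (N : ℕ) (c : ℝ) (f : ℕ → ℝ) : Alt N (fun j => c * f j) = c * Alt N f := by
  unfold Alt
  rw [Finset.mul_sum]
  apply Finset.sum_congr rfl; intros; ring

lemma Alt_sum (N : ℕ) (T : Finset ℕ) (f : ℕ → ℕ → ℝ) :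
    Alt N (fun j => ∑ i ∈ T, f i j) = ∑ i ∈ T, Alt N (f i) := by
  unfold Alt
  rw [Finset.sum_comm]
  apply Finset.sum_congr rfl; intros; rw [Finset.mul_sum]

/-- The tail quantity `x B(x, N+1)`. -/
noncomputable def tailB (N : ℕ) (x : ℝ) : ℝ := N.factorial / ∏ i ∈ Finset.range N, (x + 1 + i)

lemma tailB_eq (N : ℕ) (x : ℝ) (hx : 0 < x) :
    FAlt N (fun j => 1 / ((j : ℝ) + x)) = 1 / x * tailB N x := by
  rw [FAlt_inv N x hx, tailB]
  have e1 : ∏ i ∈ Finset.range (N + 1), (x + (i : ℝ))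
      = x * ∏ i ∈ Finset.range N, (x + 1 + (i : ℝ)) := by
    rw [Finset.prod_range_succ', mul_comm]
    congr 1
    · simp
    · apply Finset.prod_congr rfl; intro i _; push_cast; ring
  rw [e1]
  have p2 : 0 < ∏ i ∈ Finset.range N, (x + 1 + (i : ℝ)) :=
    Finset.prod_pos (fun i _ => by positivity)
  field_simp

lemma tailB_nonneg (N : ℕ) (x : ℝ) (hx : 0 < x) : 0 ≤ tailB N x := by
  unfold tailB
  apply div_nonneg (by positivity)
  exact Finset.prod_nonneg (fun i _ => by positivity)

lemma tailB_anti (N : ℕ) (x y : ℝ) (hx : 0 < x) (hxy : x ≤ y) : tailB N y ≤ tailB N x := by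
  unfold tailB
  apply div_le_div_of_nonneg_left (by positivity)
  · exact Finset.prod_pos (fun i _ => by positivity)
  · apply Finset.prod_le_prod
    · intro i _; positivity
    · intro i _; linarith

lemma finite_bound (s₁ : ℝ) (hs₁ : s₁ ∈ Set.Ioo (-1:ℝ) 0) (M : ℕ) (hM : 1 ≤ M)
    (hpos : 0 ≤ HM M (s₁ - 1)) (N : ℕ) (hN : 1 ≤ N) :
    |Alt N (fun j => 1 / HM M j) - (1 / ∑ k ∈ Finset.range M, 1 / ((k : ℝ) + 1) ^ 2) * harm N
      - (∑ k ∈ Finset.range M, 1 / ((k : ℝ) + 1) ^ 3)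
        / (∑ k ∈ Finset.range M, 1 / ((k : ℝ) + 1) ^ 2) ^ 2|
      ≤ (∑ k ∈ Finset.range M, 1 / ((k : ℝ) + 1) ^ 3)
        / (∑ k ∈ Finset.range M, 1 / ((k : ℝ) + 1) ^ 2) ^ 2 * tailB N (1 - s₁) := by
  obtain ⟨w, ρ, hw, hpf⟩ := HM_structure s₁ hs₁ M hM hpos
  have hs0 : 0 < 1 - s₁ := by have := hs₁.2; linarith
  have hρ : ∀ i ∈ Finset.Ico 1 M, 0 < ρ i := fun i hi => lt_of_lt_of_le hs0 (hw i hi).2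
  have hc := HM_const M hM w ρ hρ hpf
  rw [← hc]
  set a := (1 / ∑ k ∈ Finset.range M, 1 / ((k : ℝ) + 1) ^ 2)
  have hA : Alt N (fun j => 1 / HM M j) = 1 / harm M + a * harm N
      + ∑ i ∈ Finset.Ico 1 M, w i * (1 / ρ i - 1 / ρ i * tailB N (ρ i)) := by
    have e1 : Alt N (fun j => 1 / HM M j) = Alt N (fun j => 1 / harm M * 1 + a * (1 / (j : ℝ))
        + ∑ i ∈ Finset.Ico 1 M, w i * (1 / ((j : ℝ) + ρ i))) := by
      unfold Alt
      apply Finset.sum_congr rfl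
      intro j hj
      rw [Finset.mem_Icc] at hj
      have : (0:ℝ) < j := by exact_mod_cast hj.1
      simp only
      rw [hpf j this]
      congr 1
      congr 1
      · ring
      · apply Finset.sum_congr rfl; intros; ring
    rw [e1, Alt_add, Alt_add, Alt_smul, Alt_smul, Alt_one N hN, Alt_harm, Alt_sum, mul_one]
    congr 1
    apply Finset.sum_congr rfl
    intro i hi
    rw [Alt_smul, Alt_eq, tailB_eq N _ (hρ i hi)]
    simp
  have hdiff : Alt N (fun j => 1 / HM M j) - a * harm N
      - (1 / harm M + ∑ i ∈ Finset.Ico 1 M, w i / ρ i)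
      = - ∑ i ∈ Finset.Ico 1 M, w i / ρ i * tailB N (ρ i) := by
    rw [hA]
    have : ∑ i ∈ Finset.Ico 1 M, w i * (1 / ρ i - 1 / ρ i * tailB N (ρ i))
        = ∑ i ∈ Finset.Ico 1 M, w i / ρ i - ∑ i ∈ Finset.Ico 1 M, w i / ρ i * tailB N (ρ i) := by
      rw [← Finset.sum_sub_distrib]
      apply Finset.sum_congr rfl; intros; ring
    rw [this]; ring
  rw [hdiff, abs_neg, abs_of_nonneg]
  · have h1 : ∑ i ∈ Finset.Ico 1 M, w i / ρ i * tailB N (ρ i)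
        ≤ (∑ i ∈ Finset.Ico 1 M, w i / ρ i) * tailB N (1 - s₁) := by
      rw [Finset.sum_mul]
      apply Finset.sum_le_sum
      intro i hi
      apply mul_le_mul_of_nonneg_left (tailB_anti N _ _ hs0 (hw i hi).2)
      exact div_nonneg (hw i hi).1 (hρ i hi).le
    have h2 : 0 ≤ 1 / harm M * tailB N (1 - s₁) := by
      apply mul_nonneg _ (tailB_nonneg N _ hs0)
      unfold harm; positivity
    linarith
  · apply Finset.sum_nonneg
    intro i hi
    exact mul_nonneg (div_nonneg (hw i hi).1 (hρ i hi).le) (tailB_nonneg N _ (hρ i hi))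

lemma digamma_add_one' (x : ℝ) (hx : ∀ m : ℕ, x ≠ -m) : digamma (x + 1) = digamma x + 1 / x := by
  have hx0 : x ≠ 0 := by simpa using hx 0
  have hd : DifferentiableAt ℝ Real.Gamma x := Real.differentiableAt_Gamma hx
  have hx1 : ∀ m : ℕ, x + 1 ≠ -m := by
    intro m h
    apply hx (m + 1); push_cast; linarith
  have hd1 : DifferentiableAt ℝ Real.Gamma (x + 1) := Real.differentiableAt_Gamma hx1
  have h1 : HasDerivAt (fun y => Real.Gamma (y + 1)) (deriv Real.Gamma (x + 1)) x := by
    have := hd1.hasDerivAt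
    exact HasDerivAt.comp_add_const x 1 this
  have h2 : HasDerivAt (fun y => y * Real.Gamma y)
      (1 * Real.Gamma x + x * deriv Real.Gamma x) x := (hasDerivAt_id x).mul hd.hasDerivAt
  have h3 : (fun y => Real.Gamma (y + 1)) =ᶠ[nhds x] (fun y => y * Real.Gamma y) := by
    filter_upwards [eventually_ne_nhds hx0] with y hy
    exact Real.Gamma_add_one hy
  have h4 := (h1.congr_of_eventuallyEq h3.symm).unique h2
  have hG := Real.Gamma_ne_zero hx
  unfold digamma
  rw [h4, Real.Gamma_add_one hx0]
  field_simp
  ring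

lemma digamma_add_nat (x : ℝ) (hx : ∀ m : ℕ, x ≠ -m) (n : ℕ) :
    digamma (x + n) = digamma x + ∑ i ∈ Finset.range n, 1 / (x + i) := by
  induction n with
  | zero => simp
  | succ n ih =>
    rw [Finset.sum_range_succ, ← add_assoc, ← ih]
    push_cast
    rw [← add_assoc]
    apply digamma_add_one'
    intro m h
    apply hx (m + n); push_cast; linarith

lemma digamma_mono (x y : ℝ) (hx : 0 < x) (hxy : x ≤ y) : digamma x ≤ digamma y := by
  have hd : ∀ z ∈ Set.Ioi (0:ℝ), DifferentiableAt ℝ Real.Gamma z := by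
    intro z hz
    apply Real.differentiableAt_Gamma
    intro m h
    have : (0:ℝ) < z := hz
    have : (0:ℝ) ≤ m := by positivity
    linarith
  have hl : ∀ z ∈ Set.Ioi (0:ℝ), HasDerivAt (Real.log ∘ Real.Gamma) (digamma z) z := by
    intro z hz
    exact (hd z hz).hasDerivAt.log (Real.Gamma_pos_of_pos hz).ne'
  have := Real.convexOn_log_Gamma.monotoneOn_deriv (fun z hz => (hl z hz).differentiableAt)
  have hy : 0 < y := by linarith
  have h := this hx hy hxy
  rwa [(hl x hx).deriv, (hl y hy).deriv] at h

lemma HM_nonneg_at_root (s₁ : ℝ) (hs₁ : s₁ ∈ Set.Ioo (-1:ℝ) 0) (hroot : digamma s₁ = digamma 1)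
    (M : ℕ) (hM : 1 ≤ M) : 0 ≤ HM M (s₁ - 1) := by
  have h1 := digamma_add_nat 1 (by intro m h; have : (0:ℝ) ≤ m := by positivity
                                   linarith) M
  have h2 := digamma_add_nat s₁ (by
    intro m h
    have a := hs₁.1
    have b := hs₁.2
    rcases Nat.eq_zero_or_pos m with hm | hm
    · subst hm; simp at h; linarith
    · have : (1:ℝ) ≤ m := by exact_mod_cast hm
      linarith) M
  have hM' : (1:ℝ) ≤ M := by exact_mod_cast hM
  have h3 := digamma_mono (s₁ + M) (1 + M) (by have := hs₁.1; linarith) (by have := hs₁.2; linarith)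
  have : HM M (s₁ - 1) = ∑ i ∈ Finset.range M, 1 / ((1:ℝ) + i)
      - ∑ i ∈ Finset.range M, 1 / (s₁ + i) := by
    unfold HM
    rw [Finset.sum_sub_distrib]
    congr 1
    · apply Finset.sum_congr rfl; intro i _; rw [add_comm]
    · apply Finset.sum_congr rfl; intro i _; congr 1; ring
  rw [this]
  linarith

open Filter Topology

lemma HM_tendsto (j : ℕ) : Tendsto (fun M => HM M j) atTop (𝓝 (harm j)) := by
  induction j with
  | zero => simp [HM, harm]
  | succ j ih =>
    have hdiff : ∀ M : ℕ, HM M ((j + 1 : ℕ) : ℝ) = HM M j + (1 / ((j : ℝ) + 1) - 1 / ((M : ℝ) + j + 1)) := by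
      intro M
      induction M with
      | zero => simp [HM]
      | succ M ihM =>
        have e : ∀ s : ℝ, HM (M + 1) s = HM M s + (1 / ((M : ℝ) + 1) - 1 / ((M : ℝ) + 1 + s)) := by
          intro s; unfold HM; rw [Finset.sum_range_succ]
        rw [e, e, ihM]
        push_cast
        have e2 : (M : ℝ) + 1 + (j + 1) = (M : ℝ) + 1 + j + 1 := by ring
        have e3 : (M : ℝ) + 1 + j = (M : ℝ) + j + 1 := by ring
        rw [e2, e3]
        ring
    have h5 : harm (j + 1) = harm j + (1 / ((j : ℝ) + 1) - 0) := by
      unfold harm; rw [Finset.sum_range_succ]; ring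
    rw [h5]
    simp_rw [hdiff]
    apply ih.add
    apply tendsto_const_nhds.sub
    have h := (tendsto_one_div_add_atTop_nhds_zero_nat (𝕜 := ℝ)).comp (tendsto_add_atTop_nat j)
    refine h.congr (fun M => ?_)
    simp

lemma z2_tendsto : Tendsto (fun M : ℕ => ∑ k ∈ Finset.range M, 1 / ((k : ℝ) + 1) ^ 2) atTop
    (𝓝 (Real.pi ^ 2 / 6)) := by
  have h := hasSum_zeta_two
  rw [← hasSum_nat_add_iff' 1] at h
  have h2 := h.tendsto_sum_nat
  simpa using h2

lemma z3_tendsto : Tendsto (fun M : ℕ => ∑ k ∈ Finset.range M, 1 / ((k : ℝ) + 1) ^ 3) atTop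
    (𝓝 zeta3) := by
  have hs : Summable (fun k : ℕ => (1 : ℝ) / ((k : ℝ) + 1) ^ 3) := by
    have := (Real.summable_one_div_nat_pow (p := 3)).2 (by norm_num)
    have h2 := (summable_nat_add_iff 1).2 this
    refine h2.congr (fun k => ?_)
    push_cast; rfl
  exact hs.hasSum.tendsto_sum_nat

lemma limit_bound (s₁ : ℝ) (hs₁ : s₁ ∈ Set.Ioo (-1:ℝ) 0) (hroot : digamma s₁ = digamma 1)
    (N : ℕ) (hN : 1 ≤ N) :
    |Alt N (fun j => 1 / harm j) - (1 / (Real.pi ^ 2 / 6)) * harm N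
      - zeta3 / (Real.pi ^ 2 / 6) ^ 2|
      ≤ zeta3 / (Real.pi ^ 2 / 6) ^ 2 * tailB N (1 - s₁) := by
  have hpi : Real.pi ^ 2 / 6 ≠ 0 := by positivity
  have hA : Tendsto (fun M => Alt N (fun j => 1 / HM M j)) atTop (𝓝 (Alt N (fun j => 1 / harm j))) := by
    unfold Alt
    apply tendsto_finsetSum
    intro j hj
    rw [Finset.mem_Icc] at hj
    apply Tendsto.const_mul
    apply tendsto_const_nhds.div (HM_tendsto j)
    unfold harm
    apply ne_of_gt
    apply Finset.sum_pos
    · intro i _; positivity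
    · simp; omega
  have hz := z3_tendsto.div (z2_tendsto.pow 2) (pow_ne_zero 2 hpi)
  have hL := ((hA.sub (((tendsto_const_nhds (x := (1:ℝ))).div z2_tendsto hpi).mul_const
    (harm N))).sub hz).abs
  have hR := hz.mul_const (tailB N (1 - s₁))
  refine le_of_tendsto_of_tendsto hL hR ?_
  filter_upwards [eventually_ge_atTop 1] with M hM
  exact finite_bound s₁ hs₁ M hM (HM_nonneg_at_root s₁ hs₁ hroot M hM) N hN

lemma tailB_bound (x : ℝ) (hx : 0 < x) : ∃ C : ℝ, 0 ≤ C ∧ ∀ n : ℕ, 2 ≤ n →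
    tailB (n - 1) x ≤ C * (n : ℝ) ^ (-x) := by
  obtain ⟨B, hB⟩ := (Real.GammaSeq_tendsto_Gamma x).bddAbove_range
  refine ⟨x * |B| * 2 ^ x, by positivity, ?_⟩
  intro n hn
  obtain ⟨N, rfl⟩ : ∃ N, n = N + 1 := ⟨n - 1, by omega⟩
  rw [Nat.add_sub_cancel]
  have hN : 1 ≤ N := by omega
  have hN' : (1:ℝ) ≤ N := by exact_mod_cast hN
  have h1 : Real.GammaSeq x N ≤ |B| := (hB ⟨N, rfl⟩).trans (le_abs_self B)
  have h2 : Real.GammaSeq x N = (N : ℝ) ^ x * (1 / x * tailB N x) := by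
    rw [← tailB_eq N x hx, FAlt_inv N x hx, Real.GammaSeq]; ring
  rw [h2] at h1
  have hp : 0 < (N : ℝ) ^ x := by positivity
  have h3 : tailB N x ≤ x * |B| * (N : ℝ) ^ (-x) := by
    rw [Real.rpow_neg (by positivity)]
    have : tailB N x = x * ((N : ℝ) ^ x * (1 / x * tailB N x)) * ((N : ℝ) ^ x)⁻¹ := by
      field_simp
    rw [this]
    gcongr
  refine h3.trans ?_
  rw [mul_assoc (x * |B|)]
  apply mul_le_mul_of_nonneg_left _ (by positivity)
  have h4 : ((N + 1 : ℕ) : ℝ) ^ x ≤ 2 ^ x * (N : ℝ) ^ x := by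
    rw [← Real.mul_rpow (by norm_num) (by positivity)]
    apply Real.rpow_le_rpow (by positivity) _ hx.le
    push_cast; linarith
  rw [Real.rpow_neg (by positivity), Real.rpow_neg (by positivity)]
  have hq : 0 < ((N + 1 : ℕ) : ℝ) ^ x := by positivity
  rw [inv_eq_one_div, ← div_eq_mul_inv, div_le_div_iff₀ hp hq]
  linarith

lemma harm_bound (n : ℕ) (hn : 1 ≤ n) :
    |harm (n - 1) - Real.log n - Real.eulerMascheroniConstant + 1 / (2 * (n : ℝ))|
      ≤ 1 / (n : ℝ) ^ 2 := by
  -- shifted sequences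
  set e : ℕ → ℝ := fun m => harm m - Real.log ((m : ℝ) + 1) + 1 / (2 * ((m : ℝ) + 1)) with he
  set f : ℕ → ℝ := fun m => e m + 1 / ((m : ℝ) + 1) ^ 2 with hf
  have hinv : Tendsto (fun m : ℕ => 1 / ((m : ℝ) + 1)) atTop (𝓝 0) :=
    tendsto_one_div_add_atTop_nhds_zero_nat
  have hte : Tendsto e atTop (𝓝 Real.eulerMascheroniConstant) := by
    have h1 := Real.tendsto_eulerMascheroniSeq
    have h2 := h1.add (hinv.const_mul (1/2))
    rw [mul_zero, add_zero] at h2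
    refine h2.congr (fun m => ?_)
    rw [he]
    simp only [Real.eulerMascheroniSeq, harmonic, harm]
    push_cast
    have : (m : ℝ) + 1 ≠ 0 := by positivity
    simp only [one_div]
    rw [mul_inv]
  have htf : Tendsto f atTop (𝓝 Real.eulerMascheroniConstant) := by
    have h2 := hte.add (hinv.pow 2)
    simp only [ne_eq, OfNat.ofNat_ne_zero, not_false_eq_true, zero_pow, add_zero] at h2
    refine h2.congr (fun m => ?_)
    rw [hf]; simp
  have hstep : ∀ m : ℕ, e (m + 1) - e m = 1 / ((m : ℝ) + 1)
      - Real.log (1 + 1 / ((m : ℝ) + 1)) + 1 / (2 * ((m : ℝ) + 2)) - 1 / (2 * ((m : ℝ) + 1)) := by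
    intro m
    have h5 : harm (m + 1) = harm m + 1 / ((m : ℝ) + 1) := by
      unfold harm; rw [Finset.sum_range_succ]
    have h6 : Real.log (1 + 1 / ((m : ℝ) + 1)) = Real.log ((m : ℝ) + 2) - Real.log ((m : ℝ) + 1) := by
      rw [← Real.log_div (by positivity) (by positivity)]
      congr 1
      field_simp
      ring
    simp only [he]
    rw [h5, h6]
    push_cast
    have : (m : ℝ) + 1 + 1 = m + 2 := by ring
    rw [this]
    ring
  have hmono : Monotone e := by
    apply monotone_nat_of_le_succ
    intro m
    have h := hstep m
    have hl : Real.log (1 + 1 / ((m : ℝ) + 1)) ≤ Real.sinh (Real.log (1 + 1 / ((m : ℝ) + 1))) := by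
      rw [Real.self_le_sinh_iff]
      apply Real.log_nonneg
      have : 0 < 1 / ((m : ℝ) + 1) := by positivity
      linarith
    rw [Real.sinh_log (by positivity)] at hl
    have h2 : (1 + 1 / ((m : ℝ) + 1) - (1 + 1 / ((m : ℝ) + 1))⁻¹) / 2
        = 1 / ((m : ℝ) + 1) + 1 / (2 * ((m : ℝ) + 2)) - 1 / (2 * ((m : ℝ) + 1)) := by
      have : 1 + 1 / ((m : ℝ) + 1) = (m + 2) / (m + 1) := by field_simp; ring
      rw [this]
      field_simp
      ring
    linarith
  have hanti : Antitone f := by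
    apply antitone_nat_of_succ_le
    intro m
    have h := hstep m
    have hl := Real.le_log_one_add_of_nonneg (x := 1 / ((m : ℝ) + 1)) (by positivity)
    have h2 : 2 * (1 / ((m : ℝ) + 1)) / (1 / ((m : ℝ) + 1) + 2) = 2 / (2 * (m : ℝ) + 3) := by
      field_simp
      ring
    rw [h2] at hl
    simp only [hf]
    push_cast
    have e1 : (m : ℝ) + 1 + 1 = m + 2 := by ring
    rw [e1]
    have key : 1 / ((m : ℝ) + 1) - 2 / (2 * (m : ℝ) + 3) + 1 / (2 * ((m : ℝ) + 2))
        - 1 / (2 * ((m : ℝ) + 1)) + 1 / ((m : ℝ) + 2) ^ 2 ≤ 1 / ((m : ℝ) + 1) ^ 2 := by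
      have hm : (0:ℝ) ≤ m := by positivity
      have e2 : 1 / ((m : ℝ) + 1) - 2 / (2 * (m : ℝ) + 3) + 1 / (2 * ((m : ℝ) + 2))
        - 1 / (2 * ((m : ℝ) + 1)) = 1 / (2 * (m + 1) * (m + 2) * (2 * m + 3)) := by
        field_simp; ring
      have e3 : 1 / ((m : ℝ) + 1) ^ 2 - 1 / ((m : ℝ) + 2) ^ 2
          = (2 * m + 3) / ((m + 1) ^ 2 * (m + 2) ^ 2) := by
        field_simp; ring
      have e4 : 1 / (2 * ((m : ℝ) + 1) * (m + 2) * (2 * m + 3))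
          ≤ (2 * m + 3) / ((m + 1) ^ 2 * (m + 2) ^ 2) := by
        rw [div_le_div_iff₀ (by positivity) (by positivity)]
        have : 0 ≤ ((m:ℝ) + 1) * (m + 2) * (2 * (2 * m + 3) ^ 2 - (m + 1) * (m + 2)) := by
          apply mul_nonneg (by positivity); nlinarith
        nlinarith
      linarith
    linarith
  obtain ⟨m, rfl⟩ : ∃ m, n = m + 1 := ⟨n - 1, by omega⟩
  have h1 := hmono.ge_of_tendsto hte m
  have h2 := hanti.le_of_tendsto htf m
  rw [Nat.add_sub_cancel]
  push_cast
  simp only [hf, he] at h1 h2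
  rw [abs_le]
  have : 0 ≤ 1 / ((m : ℝ) + 1) ^ 2 := by positivity
  constructor <;> linarith

/--
Let `S(n) := Σ_{j=1}^{n-1} (-1)^{j-1} C(n-1, j) / h_j`, and let `s₁ ∈ (-1,0)` be the unique
root of `ψ(s) = ψ(1)` in `(-1,0)`. Then there is a constant `C` such that for all `n ≥ 2`,
`|S(n) - (6/π²)·log n - (ζ(3)/ζ(2)² + γ/ζ(2)) + 3/(π²·n)| ≤ C · n^{-1-|s₁|}`,
where `γ` is the Euler–Mascheroni constant, `ζ(2) = π²/6` and `ζ(3) = Σ_{k≥1} k⁻³`.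
-/
theorem stmt13 (s₁ : ℝ) (hs₁ : s₁ ∈ Set.Ioo (-1:ℝ) 0) (hroot : digamma s₁ = digamma 1) :
    ∃ C : ℝ, ∀ n : ℕ, 2 ≤ n →
      |S n - (6 / Real.pi ^ 2) * Real.log n
          - (zeta3 / (Real.pi ^ 2 / 6) ^ 2
              + Real.eulerMascheroniConstant / (Real.pi ^ 2 / 6))
          + 3 / (Real.pi ^ 2 * n)|
        ≤ C * (n : ℝ) ^ (-1 - |s₁|) := by

  have hs0 : 0 < 1 - s₁ := by have := hs₁.2; linarith
  have habs : -1 - |s₁| = -(1 - s₁) := by rw [abs_of_neg hs₁.2]; ring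
  obtain ⟨C, hC0, hC⟩ := tailB_bound (1 - s₁) hs0
  set c := zeta3 / (Real.pi ^ 2 / 6) ^ 2 with hc
  have hc0 : 0 ≤ c := by
    apply div_nonneg _ (by positivity)
    exact tsum_nonneg (fun k => by positivity)
  refine ⟨c * C + 1 / (Real.pi ^ 2 / 6), ?_⟩
  intro n hn
  have hn1 : (1:ℝ) ≤ n := by exact_mod_cast (by omega : 1 ≤ n)
  have h1 := limit_bound s₁ hs₁ hroot (n - 1) (by omega)
  rw [← hc] at h1
  have h2 := harm_bound n (by omega)
  have hS : S n = Alt (n - 1) (fun j => 1 / harm j) := by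
    unfold S Alt
    apply Finset.sum_congr rfl; intros; ring
  rw [← hS] at h1
  have h3 : 1 / (n : ℝ) ^ 2 ≤ (n : ℝ) ^ (-1 - |s₁|) := by
    have : 1 / (n : ℝ) ^ 2 = (n : ℝ) ^ (-2 : ℝ) := by
      rw [Real.rpow_neg (by positivity), one_div]; norm_cast
    rw [this]
    apply Real.rpow_le_rpow_of_exponent_le hn1
    rw [habs]; have := hs₁.1; linarith
  have h4 := hC n hn
  rw [← habs] at h4
  set p := (n : ℝ) ^ (-1 - |s₁|)
  have hpi : 0 < Real.pi := Real.pi_pos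
  have hsplit : S n - (6 / Real.pi ^ 2) * Real.log n
      - (c + Real.eulerMascheroniConstant / (Real.pi ^ 2 / 6)) + 3 / (Real.pi ^ 2 * n)
      = (S n - (1 / (Real.pi ^ 2 / 6)) * harm (n - 1) - c)
        + (1 / (Real.pi ^ 2 / 6)) * (harm (n - 1) - Real.log n - Real.eulerMascheroniConstant
          + 1 / (2 * (n : ℝ))) := by
    field_simp
    ring
  rw [hsplit]
  refine (abs_add_le _ _).trans ?_
  rw [abs_mul, abs_of_nonneg (by positivity : 0 ≤ 1 / (Real.pi ^ 2 / 6)), add_mul]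
  apply add_le_add
  · refine h1.trans ?_
    rw [mul_assoc]
    exact mul_le_mul_of_nonneg_left h4 hc0
  · exact mul_le_mul_of_nonneg_left (h2.trans h3) (by positivity)
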